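/- Let G=(N,E) be a DAG with each state space X_s having at least two elements, and let G'=G*=(N,E*) be the graph obtained by reversing all edges of G. Then P^{G'} ⊇ P^G if and only if for every s ∈ N both pa_G(s) and ch_G(s) are complete. -/

import Mathlib

open Finset

/-! Basic graph-theoretic definitions for Bayesian networks. -/

/-- Two nodes are joined (adjacent) in the directed graph `E`. -/
def GJoined {V : Type*} (E : V → V → Prop) (a b : V) : Prop := E a b ∨ E b a

/-- A directed graph (given by its edge relation) is a DAG iff it has no cycles:
no node can reach itself by a nonempty directed walk. -/
def IsDAG {V : Type*} (E : V → V → Prop) : Prop := ∀ s, ¬ Relation.TransGen E s s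

/-- The set of parents of `s`. -/
def paG {V : Type*} (E : V → V → Prop) (s : V) : Set V := {t | E t s}

/-- The set of children of `s`. -/
def chG {V : Type*} (E : V → V → Prop) (s : V) : Set V := {t | E s t}

/-- The set of descendants of `s` (nodes reachable from `s` by a nonempty directed path). -/
def desG {V : Type*} (E : V → V → Prop) (s : V) : Set V := {t | Relation.TransGen E s t}

/-- A set of nodes is complete if all pairs of distinct elements are joined. -/
def GComplete {V : Type*} (E : V → V → Prop) (S : Set V) : Prop :=
  ∀ a ∈ S, ∀ b ∈ S, a ≠ b → GJoined E a b

/-- A directed graph is perfect if the parent set of every node is complete. -/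
def GPerfect {V : Type*} (E : V → V → Prop) : Prop := ∀ s, GComplete E (paG E s)

/-- `a` and `b` are joined in the moral graph `G^M` of `E`:
either joined in `E` or distinct common parents of some node. -/
def MoralEdge {V : Type*} (E : V → V → Prop) (a b : V) : Prop :=
  E a b ∨ E b a ∨ (a ≠ b ∧ ∃ s, E a s ∧ E b s)

/-- A topological ordering of a graph on a finite node set: an injective map into
`{1, …, |N|}` (encoded as `Fin (card V)`) increasing along edges. -/
def IsTopo {V : Type*} [Fintype V] (E : V → V → Prop) (O : V → Fin (Fintype.card V)) : Prop :=
  Function.Injective O ∧ ∀ s t, E s t → O s < O t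

/-! d-separation. -/

/-- `u` is a v-structure (collider) of the trail `l` in the graph `E`. -/
def VStruct {V : Type*} (E : V → V → Prop) (l : List V) (u : V) : Prop :=
  ∃ l₁ l₂ a b, l = l₁ ++ a :: u :: b :: l₂ ∧ E a u ∧ E b u

/-- `l` is a trail in the graph `E`: a nonempty sequence of distinct nodes consecutively joined. -/
def IsTrail {V : Type*} (E : V → V → Prop) (l : List V) : Prop :=
  l ≠ [] ∧ l.Nodup ∧ l.Chain' (GJoined E)

/-- The trail `l` is blocked by `S`. -/
def BlockedBy {V : Type*} (E : V → V → Prop) (S : Set V) (l : List V) : Prop :=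
  ∃ u ∈ l, (u ∈ S ∧ ¬ VStruct E l u) ∨
    (VStruct E l u ∧ u ∉ S ∧ ∀ t ∈ desG E u, t ∉ S)

/-- d-separation: every trail from a node of `A` to a node of `B` is blocked by `S`. -/
def DSep {V : Type*} (E : V → V → Prop) (A B S : Set V) : Prop :=
  ∀ (l : List V) (a b : V), IsTrail E l → l.head? = some a → l.getLast? = some b →
    a ∈ A → b ∈ B → BlockedBy E S l

/-- The set of leaves (childless nodes), as a `Finset`. -/
def leavesF {V : Type*} [Fintype V] (E : V → V → Prop) [DecidableRel E] : Finset V :=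
  Finset.univ.filter fun s => ∀ t, ¬ E s t

/-! Probability on graphs (finite state spaces, pmfs). -/

section Prob

variable {V : Type*} [Fintype V] [DecidableEq V]
variable (X : V → Type*) [∀ v, Fintype (X v)]

/-- `p` is a probability mass function on `X_N = ∏ v, X v`. -/
def IsPMF (p : (∀ v, X v) → ℝ) : Prop :=
  (∀ x, 0 ≤ p x) ∧ ∑ x, p x = 1

/-- `k` is a kernel function for the node `s` w.r.t. the graph `E`: it is nonnegative,
depends on the configuration only through the parents of `s` in `E`, and is normalized. -/
def IsKernel (E : V → V → Prop) (s : V) (k : X s → (∀ v, X v) → ℝ) : Prop :=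
  (∀ a x, 0 ≤ k a x) ∧
  (∀ a x y, (∀ t, E t s → x t = y t) → k a x = k a y) ∧
  (∀ x, ∑ a, k a x = 1)

/-- `p` factorizes over the graph `E`: it is a product of kernel functions, one per node. -/
def Factorizes (E : V → V → Prop) (p : (∀ v, X v) → ℝ) : Prop :=
  ∃ k : ∀ s, X s → (∀ v, X v) → ℝ,
    (∀ s, IsKernel X E s (k s)) ∧ ∀ x, p x = ∏ s, k s (x s) x

variable [∀ v, DecidableEq (X v)]

/-- The marginal of `p` on the coordinates in `C`, evaluated at (the `C`-part of) `x`. -/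
def marg (p : (∀ v, X v) → ℝ) (C : Finset V) (x : ∀ v, X v) : ℝ :=
  ∑ y, if ∀ v ∈ C, y v = x v then p y else 0

/-- Conditional independence `A ⟂⟂ B ∣ S` w.r.t. the pmf `p`. -/
def CondIndep (p : (∀ v, X v) → ℝ) (A B S : Finset V) : Prop :=
  ∀ x, 0 < marg X p S x →
    marg X p (A ∪ B ∪ S) x * marg X p S x = marg X p (A ∪ S) x * marg X p (B ∪ S) x

/-- `q` is a conditional system for `N ∖ A` given `A`: a family of pmfs on `X_{N∖A}`,
one for every configuration on `A`.  Here `q x` encodes `q(x_{N∖A} ∣ x_A)`. -/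
def IsCondSystem (A : Finset V) (q : (∀ v, X v) → ℝ) : Prop :=
  (∀ x, 0 ≤ q x) ∧ ∀ x : ∀ v, X v, (∑ y, if ∀ v ∈ A, y v = x v then q y else 0) = 1

/-- The conditional system `q` for `N ∖ A` given `A` factorizes over the graph `E`. -/
def CondFactorizes (E : V → V → Prop) (A : Finset V) (q : (∀ v, X v) → ℝ) : Prop :=
  ∃ k : ∀ s, X s → (∀ v, X v) → ℝ,
    (∀ s ∉ A, IsKernel X E s (k s)) ∧ ∀ x, q x = ∏ s ∈ Finset.univ \ A, k s (x s) x

/-- The conditional system `q` for `N ∖ A` given `A` is a version of the conditional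
distribution of the pmf `p`. -/
def IsVersionOf (A : Finset V) (q p : (∀ v, X v) → ℝ) : Prop :=
  ∀ x, p x = q x * marg X p A x

/-- `G'` (edges `E'`) satisfies Goal I for `G` (edges `E`): `roots(G') ⊇ leaves(G)` and for
every pmf factorizing over `G` there is a conditional system for `N ∖ leaves(G)` given
`leaves(G)` factorizing over `G'` which is a version of its conditional distribution. -/
def GoalI (E E' : V → V → Prop) [DecidableRel E] : Prop :=
  (∀ s ∈ leavesF E, ∀ t, ¬ E' t s) ∧
  ∀ p : (∀ v, X v) → ℝ, IsPMF X p → Factorizes X E p →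
    ∃ q, IsCondSystem X (leavesF E) q ∧ CondFactorizes X E' (leavesF E) q ∧
      IsVersionOf X (leavesF E) q p

/-- `G'` (edges `E'`) satisfies Goal II for `G` (edges `E`): `P^{G'} ⊇ P^G` and every parent
in `G'` of a leaf of `G` is itself a leaf of `G`. -/
def GoalII (E E' : V → V → Prop) : Prop :=
  (∀ p : (∀ v, X v) → ℝ, IsPMF X p → Factorizes X E p → Factorizes X E' p) ∧
  ∀ s t, (∀ u, ¬ E s u) → E' t s → ∀ u, ¬ E t u

end Prob


section Auxiliary

/-- A DAG on finitely many nodes has an injective ranking that increases along edges. -/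
theorem IsDAG.exists_rank {V : Type*} [Fintype V] {E : V → V → Prop} (hE : IsDAG E) :
    ∃ O : V → ℕ, Function.Injective O ∧ ∀ a b, E a b → O a < O b := by
  classical
  let anc : V → Finset V := fun a => univ.filter fun b => Relation.TransGen E b a
  let e := Fintype.equivFin V
  refine ⟨fun a => (e a : ℕ) + Fintype.card V * (anc a).card, fun a b hab => ?_,
    fun a b hab => ?_⟩
  · have h := congrArg (· % Fintype.card V) hab
    simp only [Nat.add_mul_mod_self_left, Nat.mod_eq_of_lt (e _).isLt] at h
    exact e.injective (Fin.ext h)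
  · have hlt : (anc a).card < (anc b).card := by
      refine card_lt_card ⟨fun c hc => ?_, fun h => ?_⟩
      · simp only [anc, mem_filter, mem_univ, true_and] at hc ⊢
        exact hc.tail hab
      · have ha : a ∈ anc a := h (by simpa [anc] using Relation.TransGen.single hab)
        simp only [anc, mem_filter, mem_univ, true_and] at ha
        exact hE a ha
    have h1 : Fintype.card V * ((anc a).card + 1) ≤ Fintype.card V * (anc b).card :=
      Nat.mul_le_mul_left _ hlt
    have h2 := (e a).isLt
    dsimp only
    rw [Nat.mul_add] at h1
    omega

theorem IsDAG.reverse {V : Type*} {E : V → V → Prop} (hE : IsDAG E) :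
    IsDAG fun a b => E b a :=
  fun s hs => hE s (Relation.transGen_swap.1 hs)

variable {V : Type*} [Fintype V] {X : V → Type*} [∀ v, Fintype (X v)]

theorem prod_kernel_pos_iff {E : V → V → Prop} {k : ∀ s, X s → (∀ v, X v) → ℝ}
    (hk : ∀ s, IsKernel X E s (k s)) (x : ∀ v, X v) :
    0 < ∏ s, k s (x s) x ↔ ∀ s, 0 < k s (x s) x := by
  refine ⟨fun h s => ((hk s).1 _ _).lt_of_ne' fun h0 => ?_, fun h => prod_pos fun s _ => h s⟩
  exact h.ne' (prod_eq_zero (mem_univ s) h0)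

variable [DecidableEq V]

/-- Resampling one coordinate multiplies the total sum by the number of its values. -/
theorem sum_sum_update (v : V) (g : (∀ u, X u) → ℝ) :
    ∑ x, ∑ c : X v, g (Function.update x v c) = Fintype.card (X v) * ∑ x, g x := by
  let f : (∀ u, X u) × X v → (∀ u, X u) × X v := fun q => (Function.update q.1 v q.2, q.1 v)
  have hf : Function.Involutive f := fun q => by simp [f]
  calc ∑ x, ∑ c : X v, g (Function.update x v c)
      = ∑ q : (∀ u, X u) × X v, g (f q).1 := by rw [Fintype.sum_prod_type]
    _ = ∑ q : (∀ u, X u) × X v, g q.1 := Equiv.sum_comp hf.toPerm fun q => g q.1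
    _ = _ := by simp [Fintype.sum_prod_type, mul_sum]

/-- A product of kernel functions along a DAG has total mass one. -/
theorem sum_prod_kernel {E : V → V → Prop} (hX : ∀ v, Nonempty (X v)) {O : V → ℕ}
    (hO : ∀ a b, E a b → O a < O b) {k : ∀ s, X s → (∀ v, X v) → ℝ}
    (hk : ∀ s, IsKernel X E s (k s)) : ∑ x, ∏ s, k s (x s) x = 1 := by
  have hcard : ∀ v, (Fintype.card (X v) : ℝ) ≠ 0 := fun v => by
    have := hX v
    exact_mod_cast Fintype.card_ne_zero
  suffices h : ∀ A : Finset V,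
      ∑ x, ∏ s ∈ A, k s (x s) x = ∏ s ∈ univ \ A, (Fintype.card (X s) : ℝ) by
    simpa using h univ
  intro A
  induction A using Finset.induction_on_max_value O with
  | empty => simp
  | insert v A hv hmax ih =>
    have hF : ∀ (x : ∀ u, X u) (c : X v),
        ∏ s ∈ A, k s (Function.update x v c s) (Function.update x v c) =
          ∏ s ∈ A, k s (x s) x := by
      intro x c
      refine prod_congr rfl fun s hs => ?_
      have hsv : s ≠ v := fun h => hv (h ▸ hs)
      rw [Function.update_of_ne hsv]
      refine (hk s).2.1 _ _ _ fun t hts => Function.update_of_ne ?_ _ _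
      rintro rfl
      exact absurd (hO _ _ hts) (not_lt.2 (hmax s hs))
    have hK : ∀ (x : ∀ u, X u) (c : X v), k v c (Function.update x v c) = k v c x := by
      intro x c
      refine (hk v).2.1 _ _ _ fun t htv => Function.update_of_ne ?_ _ _
      rintro rfl
      exact lt_irrefl _ (hO _ _ htv)
    have h := sum_sum_update v fun x : ∀ u, X u => ∏ s ∈ insert v A, k s (x s) x
    simp only [prod_insert hv, Function.update_self, hF, hK, ← sum_mul, (hk v).2.2, one_mul,
      ih] at h
    have hs : univ \ A = insert v (univ \ insert v A) := by
      ext u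
      by_cases hu : u = v <;> simp [hu, hv]
    rw [hs, prod_insert (by simp)] at h
    simp only [prod_insert hv]
    exact (mul_left_cancel₀ (hcard v) h).symm

/-- A local family of nonempty supports is realized by a distribution factorizing over a DAG. -/
theorem exists_factorizes_pos_iff {E : V → V → Prop} (hE : IsDAG E) (hX : ∀ v, Nonempty (X v))
    (T : ∀ s, (∀ v, X v) → Finset (X s)) (hT : ∀ s x, (T s x).Nonempty)
    (hloc : ∀ s x y, (∀ t, E t s → x t = y t) → T s x = T s y) :
    ∃ p : (∀ v, X v) → ℝ, IsPMF X p ∧ Factorizes X E p ∧ ∀ x, 0 < p x ↔ ∀ s, x s ∈ T s x := by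
  classical
  obtain ⟨O, -, hO⟩ := hE.exists_rank
  let k : ∀ s, X s → (∀ v, X v) → ℝ := fun s c x =>
    if c ∈ T s x then ((T s x).card : ℝ)⁻¹ else 0
  have hpos : ∀ s x, (0 : ℝ) < (T s x).card := fun s x => by exact_mod_cast (hT s x).card_pos
  have hk : ∀ s, IsKernel X E s (k s) := by
    refine fun s => ⟨fun c x => ?_, fun c x y hxy => ?_, fun x => ?_⟩
    · dsimp only [k]
      split_ifs
      exacts [inv_nonneg.2 (hpos s x).le, le_rfl]
    · simp only [k, hloc s x y hxy]
    · simp [k, mul_inv_cancel₀ (hpos s x).ne']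
  refine ⟨fun x => ∏ s, k s (x s) x,
    ⟨fun x => prod_nonneg fun s _ => (hk s).1 _ _, sum_prod_kernel hX hO hk⟩,
    ⟨k, hk, fun _ => rfl⟩, fun x => ?_⟩
  rw [prod_kernel_pos_iff hk]
  refine forall_congr' fun s => ?_
  dsimp only [k]
  split_ifs with h <;> simp [h, hpos]

/-- If two configurations in the support of a factorizing distribution agree on the parents
of `a`, then some configuration in the support takes its value at `a` from the first one and
its values at all predecessors of `a` from the second one. -/
theorem Factorizes.exists_pos {E : V → V → Prop} {O : V → ℕ}
    (hO : ∀ a b, E a b → O a < O b) {p : (∀ v, X v) → ℝ} (hp : Factorizes X E p)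
    {x y : ∀ v, X v} (hx : 0 < p x) (hy : 0 < p y) {a : V} (hxy : ∀ t, E t a → x t = y t) :
    ∃ z, 0 < p z ∧ z a = x a ∧ ∀ v, O v < O a → z v = y v := by
  obtain ⟨k, hk, hpk⟩ := hp
  simp only [hpk, prod_kernel_pos_iff hk] at hx hy ⊢
  have hext : ∀ n, ∃ z, (∀ v, O v ≤ O a ∨ O v < n → 0 < k v (z v) z) ∧
      z a = x a ∧ ∀ v, O v < O a → z v = y v := by
    intro n
    induction n with
    | zero =>
      refine ⟨Function.update y a (x a), fun v hv => ?_, by simp, fun v hv => ?_⟩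
      · have hv : O v ≤ O a := by simpa using hv
        have hloc : ∀ c, k v c (Function.update y a (x a)) = k v c y := by
          refine fun c => (hk v).2.1 _ _ _ fun t htv => Function.update_of_ne ?_ _ _
          rintro rfl
          exact absurd (hO _ _ htv) (not_lt.2 hv)
        rw [hloc]
        by_cases hva : v = a
        · subst hva
          rw [Function.update_self, ← (hk v).2.1 _ x y hxy]
          exact hx v
        · rw [Function.update_of_ne hva]
          exact hy v
      · exact Function.update_of_ne (fun h => hv.ne (congrArg O h)) _ _
    | succ n ih =>
      obtain ⟨z, hz, hza, hzy⟩ := ih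
      have hc : ∀ v, ∃ c, 0 < k v c z := by
        intro v
        by_contra! h
        have := (hk v).2.2 z
        linarith [sum_nonpos fun c (_ : c ∈ univ) => h c]
      choose c hc using hc
      let z' : ∀ v, X v := fun v => if O v ≤ O a ∨ O v < n then z v else c v
      have hz' : ∀ v, O v ≤ O a ∨ O v < n → z' v = z v := fun v hv => if_pos hv
      refine ⟨z', fun v hv => ?_, by rw [hz' a (Or.inl le_rfl), hza],
        fun v hv => by rw [hz' v (Or.inl hv.le), hzy v hv]⟩
      have hloc : ∀ d, k v d z' = k v d z := by
        refine fun d => (hk v).2.1 _ _ _ fun t htv => hz' t ?_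
        have := hO _ _ htv
        omega
      rw [hloc]
      by_cases h : O v ≤ O a ∨ O v < n
      · rw [hz' v h]
        exact hz v h
      · rw [show z' v = c v from if_neg h]
        exact hc v
  obtain ⟨z, hz, hza⟩ := hext (univ.sup O + 1)
  exact ⟨z, fun v => hz v (Or.inr (Nat.lt_succ_of_le (le_sup (mem_univ v)))), hza⟩

/-- Reversing a covered edge `s → t` preserves factorization. -/
theorem Factorizes.reverse_covered {H H' : V → V → Prop} {p : (∀ v, X v) → ℝ}
    (hp : Factorizes X H p) {s t : V} (hst : s ≠ t) (hs : ¬ H s s) (hts : ¬ H t s)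
    (hcov : ∀ u, u ≠ s → u ≠ t → H u t → H u s)
    (hH' : ∀ u v, v ≠ s → v ≠ t → H u v → H' u v)
    (hs' : ∀ u, H u s → H' u s) (hts' : H' t s) (ht' : ∀ u, H u s → H' u t)
    (htt : ¬ H t t) : Factorizes X H' p := by
  obtain ⟨k, hk, hpk⟩ := hp
  let φ : X s → X t → (∀ v, X v) → ℝ := fun a b x => k s a x * k t b (Function.update x s a)
  have hφ0 : ∀ a b x, 0 ≤ φ a b x := fun a b x => mul_nonneg ((hk s).1 _ _) ((hk t).1 _ _)
  have hφ : ∀ a b x y, (∀ u, H u s → x u = y u) → φ a b x = φ a b y := by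
    intro a b x y hxy
    dsimp only [φ]
    rw [(hk s).2.1 a x y hxy]
    congr 1
    refine (hk t).2.1 _ _ _ fun u hut => ?_
    by_cases hus : u = s
    · subst hus
      simp
    · have hne : u ≠ t := by
        rintro rfl
        exact htt hut
      rw [Function.update_of_ne hus, Function.update_of_ne hus]
      exact hxy u (hcov u hus hne hut)
  let kt : X t → (∀ v, X v) → ℝ := fun b x => ∑ a, φ a b x
  let ks : X s → (∀ v, X v) → ℝ := fun a x =>
    if kt (x t) x = 0 then k s a x else φ a (x t) x / kt (x t) x
  have hkt0 : ∀ b x, 0 ≤ kt b x := fun b x => sum_nonneg fun a _ => hφ0 a b x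
  have hktloc : ∀ b x y, (∀ u, H u s → x u = y u) → kt b x = kt b y := fun b x y hxy =>
    sum_congr rfl fun a _ => hφ a b x y hxy
  have hkt : IsKernel X H' t kt := by
    refine ⟨hkt0, fun b x y hxy => hktloc b x y fun u hu => hxy u (ht' u hu), fun x => ?_⟩
    dsimp only [kt, φ]
    rw [sum_comm]
    simp only [← mul_sum, (hk t).2.2, mul_one, (hk s).2.2]
  have hks : IsKernel X H' s ks := by
    refine ⟨fun a x => ?_, fun a x y hxy => ?_, fun x => ?_⟩
    · dsimp only [ks]
      split_ifs
      exacts [(hk s).1 _ _, div_nonneg (hφ0 _ _ _) (hkt0 _ _)]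
    · have hxy' : ∀ u, H u s → x u = y u := fun u hu => hxy u (hs' u hu)
      simp only [ks, hxy t hts', hktloc _ x y hxy', hφ _ _ x y hxy', (hk s).2.1 a x y hxy']
    · by_cases h : kt (x t) x = 0
      · simp only [ks, h, if_true, (hk s).2.2]
      · simp only [ks, h, if_false, ← sum_div]
        exact div_self h
  let k' : ∀ v, X v → (∀ v, X v) → ℝ := Function.update (Function.update k s ks) t kt
  have hk's : k' s = ks := by simp [k', hst]
  have hk't : k' t = kt := by simp [k']
  have hk' : ∀ v, v ≠ s → v ≠ t → k' v = k v := fun v h₁ h₂ => by simp [k', h₁, h₂]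
  refine ⟨k', fun v => ?_, fun x => ?_⟩
  · by_cases hvs : v = s
    · subst hvs
      rwa [hk's]
    by_cases hvt : v = t
    · subst hvt
      rwa [hk't]
    rw [hk' v hvs hvt]
    exact ⟨(hk v).1, fun a x y hxy => (hk v).2.1 a x y fun u hu => hxy u (hH' u v hvs hvt hu),
      (hk v).2.2⟩
  · have hsplit : ∀ f : V → ℝ, ∏ v, f v = f s * (f t * ∏ v ∈ (univ.erase s).erase t, f v) := by
      intro f
      rw [mul_prod_erase _ _ (by simpa using hst.symm), mul_prod_erase _ _ (mem_univ s)]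
    have hrest : ∏ v ∈ (univ.erase s).erase t, k' v (x v) x =
        ∏ v ∈ (univ.erase s).erase t, k v (x v) x := by
      refine prod_congr rfl fun v hv => ?_
      simp only [mem_erase, mem_univ, and_true] at hv
      rw [hk' v hv.2 hv.1]
    have hpair : ks (x s) x * kt (x t) x = k s (x s) x * k t (x t) x := by
      have hφx : φ (x s) (x t) x = k s (x s) x * k t (x t) x := by simp [φ]
      rw [← hφx]
      by_cases h : kt (x t) x = 0
      · rw [h, mul_zero]
        exact ((sum_eq_zero_iff_of_nonneg fun a _ => hφ0 a (x t) x).1 h _ (mem_univ _)).symm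
      · simp only [ks, h, if_false]
        exact div_mul_cancel₀ _ h
    rw [hpk, hsplit fun v => k v (x v) x, hsplit fun v => k' v (x v) x, hrest, hk's, hk't,
      ← mul_assoc, ← mul_assoc, hpair]

/-- If all parent and children sets of a DAG are complete, then every distribution factorizing
over the DAG factorizes over the reversed graph. -/
theorem Factorizes.reverse {E : V → V → Prop} (hE : IsDAG E)
    (hpa : ∀ s, GComplete E (paG E s)) (hch : ∀ s, GComplete E (chG E s))
    {p : (∀ v, X v) → ℝ} (hp : Factorizes X E p) : Factorizes X (fun a b => E b a) p := by
  obtain ⟨O, hinj, hO⟩ := hE.exists_rank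
  let M := univ.sup O + 1
  have hM : ∀ v, O v < M := fun v => Nat.lt_succ_of_le (le_sup (mem_univ v))
  let key : V → V → ℕ := fun a b => O b + M * O a
  have key_lt : ∀ {a b c d}, key a b < key c d ↔ O a < O c ∨ O a = O c ∧ O b < O d := by
    intro a b c d
    have hb := hM b
    have hd := hM d
    dsimp only [key]
    rcases lt_trichotomy (O a) (O c) with h | h | h
    · have := Nat.mul_le_mul_left M (Nat.succ_le_of_lt h)
      rw [Nat.mul_succ] at this
      omega
    · simp [h]
    · have := Nat.mul_le_mul_left M (Nat.succ_le_of_lt h)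
      rw [Nat.mul_succ] at this
      omega
  have key_inj : ∀ {a b c d}, key a b = key c d → a = c ∧ b = d := by
    intro a b c d h
    have h₁ := h.not_lt
    have h₂ := h.not_gt
    rw [key_lt] at h₁
    rw [key_lt] at h₂
    exact ⟨hinj (by omega), hinj (by omega)⟩
  let H : ℕ → V → V → Prop := fun n a b => E a b ∧ n ≤ key a b ∨ E b a ∧ key b a < n
  have hfac : ∀ n, Factorizes X (H n) p := by
    intro n
    induction n with
    | zero => simpa [H] using hp
    | succ n ih =>
      by_cases h : ∃ s t, E s t ∧ key s t = n
      · obtain ⟨s, t, hst, rfl⟩ := h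
        have hlt := hO _ _ hst
        have hirr : ∀ v, ¬ E v v := fun v hv => lt_irrefl _ (hO _ _ hv)
        have hne : s ≠ t := by
          rintro rfl
          exact hirr _ hst
        have hs : ∀ u, H (key s t) u s ↔ E s u ∧ O u < O t := by
          intro u
          simp only [H, key_lt, ← not_lt]
          have := hO u s
          grind
        have ht : ∀ u, u ≠ s → (H (key s t) u t ↔ E u t ∧ O s < O u) := by
          intro u hu
          have hne' : O u ≠ O s := fun h => hu (hinj h)
          simp only [H, key_lt, ← not_lt]
          have := hO t u
          grind
        have hmono : ∀ u v, ¬ (u = s ∧ v = t) → H (key s t) u v → H (key s t + 1) u v := by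
          rintro u v huv (⟨h₁, h₂⟩ | ⟨h₁, h₂⟩)
          · refine Or.inl ⟨h₁, lt_of_le_of_ne h₂ fun h => huv ?_⟩
            obtain ⟨rfl, rfl⟩ := key_inj h
            exact ⟨rfl, rfl⟩
          · exact Or.inr ⟨h₁, h₂.trans (Nat.lt_succ_self _)⟩
        refine ih.reverse_covered hne ?_ ?_ ?_ ?_ ?_ ?_ ?_ ?_
        · simp [hs, hirr]
        · simp [hs]
        · intro u hus hut h
          rw [ht u hus] at h
          rw [hs]
          rcases hpa t u h.1 s hst hus with h' | h'
          · exact absurd (hO _ _ h') h.2.not_gt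
          · exact ⟨h', hO _ _ h.1⟩
        · exact fun u v _ hvt h => hmono u v (fun h' => hvt h'.2) h
        · exact fun u h => hmono u s (fun h' => hne h'.2) h
        · exact Or.inr ⟨hst, Nat.lt_succ_self _⟩
        · intro u h
          have h' := (hs u).1 h
          have hus : u ≠ s := by
            rintro rfl
            exact hirr _ h'.1
          have hut : u ≠ t := fun h => h'.2.ne (congrArg O h)
          refine hmono u t (fun h' => hus h'.1) ((ht u hus).2 ⟨?_, hO _ _ h'.1⟩)
          rcases hch s u h'.1 t hst hut with h'' | h''
          · exact h''
          · exact absurd (hO _ _ h'') h'.2.not_gt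
        · rw [ht t hne.symm]
          exact fun h => hirr _ h.1
      · push Not at h
        convert ih using 1
        ext a b
        simp only [H]
        have := h a b
        have := h b a
        grind
  convert hfac (M + M * M) using 1
  ext a b
  have hbound : ∀ a b, key a b < M + M * M := fun a b =>
    Nat.add_lt_add_of_lt_of_le (hM b) (Nat.mul_le_mul_left M (hM a).le)
  have := (hbound a b).not_ge
  simp [H, hbound, this]

/-- If all distributions factorizing over a DAG also factorize over the reversed graph, then
all parent sets are complete. -/
theorem complete_paG_of_factorizes_reverse (h2 : ∀ v, 1 < Fintype.card (X v))
    {E : V → V → Prop} (hE : IsDAG E)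
    (h : ∀ p : (∀ v, X v) → ℝ, IsPMF X p → Factorizes X E p →
      Factorizes X (fun a b => E b a) p) (s : V) : GComplete E (paG E s) := by
  classical
  intro a ha b hb hab
  by_contra hj
  obtain ⟨O, hinj, hO⟩ := hE.reverse.exists_rank
  wlog hlt : O b < O a generalizing a b
  · exact this b hb a ha hab.symm (fun h => hj h.symm)
      (lt_of_le_of_ne (not_lt.1 hlt) (hinj.ne hab))
  have hirr : ∀ v, ¬ E v v := fun v hv => lt_irrefl _ (hO _ _ hv)
  choose e₀ e₁ he using fun v => Fintype.one_lt_card_iff.1 (h2 v)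
  have hsa : s ≠ a := fun h => hirr a (h ▸ ha : E a a)
  have hsb : s ≠ b := fun h => hirr b (h ▸ hb : E b b)
  let T : ∀ v, (∀ u, X u) → Finset (X v) := fun v x =>
    univ.filter fun c => v = s → (c = e₀ v ↔ (x a = e₀ a ↔ x b = e₀ b))
  obtain ⟨p, hp, hpE, hpos⟩ := exists_factorizes_pos_iff hE (fun v => ⟨e₀ v⟩) T
    (fun v x => by
      by_cases hx : x a = e₀ a ↔ x b = e₀ b
      · exact ⟨e₀ v, by simp [T, hx]⟩
      · exact ⟨e₁ v, by simp [T, hx, (he v).symm]⟩)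
    (fun v x y hxy => by
      ext c
      simp only [T, mem_filter, mem_univ, true_and]
      refine forall_congr' fun hv => ?_
      rw [hxy a (hv ▸ ha), hxy b (hv ▸ hb)])
  let y : ∀ v, X v := fun v => if v = a ∨ v = b then e₁ v else e₀ v
  have hya : y a = e₁ a := by simp [y]
  have hyb : y b = e₁ b := by simp [y]
  have hy : ∀ v, v ≠ a → v ≠ b → y v = e₀ v := fun v h₁ h₂ => by simp [y, h₁, h₂]
  obtain ⟨z, hz, hza, hzy⟩ := (h p hp hpE).exists_pos hO (x := e₀) (y := y) (a := a)
    ((hpos _).2 fun v => by simp [T])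
    ((hpos _).2 fun v => by
      simp only [T, mem_filter, mem_univ, true_and]
      rintro rfl
      simp [hya, hyb, hy v hsa hsb, (he a).symm, (he b).symm])
    (fun t hat => (hy t (fun h => hirr a (h ▸ hat)) fun h => hj (Or.inl (h ▸ hat))).symm)
  have hzs := (hpos z).1 hz s
  simp only [T, mem_filter, mem_univ, true_and, forall_const, hza, hzy b hlt, hyb,
    hzy s (hO _ _ ha), hy s hsa hsb, true_iff, (he b).symm] at hzs

/-- If all distributions factorizing over a DAG also factorize over the reversed graph, then
all children sets are complete. -/
theorem complete_chG_of_factorizes_reverse (h2 : ∀ v, 1 < Fintype.card (X v))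
    {E : V → V → Prop} (hE : IsDAG E)
    (h : ∀ p : (∀ v, X v) → ℝ, IsPMF X p → Factorizes X E p →
      Factorizes X (fun a b => E b a) p) (s : V) : GComplete E (chG E s) := by
  classical
  intro a ha b hb hab
  by_contra hj
  obtain ⟨O, hinj, hO⟩ := hE.reverse.exists_rank
  wlog hlt : O b < O a generalizing a b
  · exact this b hb a ha hab.symm (fun h => hj h.symm)
      (lt_of_le_of_ne (not_lt.1 hlt) (hinj.ne hab))
  have hirr : ∀ v, ¬ E v v := fun v hv => lt_irrefl _ (hO _ _ hv)
  choose e₀ e₁ he using fun v => Fintype.one_lt_card_iff.1 (h2 v)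
  have hsa : s ≠ a := fun h => hirr a (h ▸ ha : E a a)
  let T : ∀ v, (∀ u, X u) → Finset (X v) := fun v x =>
    univ.filter fun c => v = a ∨ v = b → (c = e₀ v ↔ x s = e₀ s)
  obtain ⟨p, hp, hpE, hpos⟩ := exists_factorizes_pos_iff hE (fun v => ⟨e₀ v⟩) T
    (fun v x => by
      by_cases hx : x s = e₀ s
      · exact ⟨e₀ v, by simp [T, hx]⟩
      · exact ⟨e₁ v, by simp [T, hx, (he v).symm]⟩)
    (fun v x y hxy => by
      ext c
      simp only [T, mem_filter, mem_univ, true_and]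
      refine forall_congr' fun hv => ?_
      rw [hxy s (hv.elim (fun h => h ▸ ha) fun h => h ▸ hb)])
  let y : ∀ v, X v := fun v => if v = a ∨ v = b ∨ v = s then e₁ v else e₀ v
  obtain ⟨z, hz, hza, hzy⟩ := (h p hp hpE).exists_pos hO (x := e₀) (y := y) (a := a)
    ((hpos _).2 fun v => by simp [T])
    ((hpos _).2 fun v => by
      simp only [T, mem_filter, mem_univ, true_and]
      rintro (rfl | rfl) <;> simp [y, (he _).symm])
    (fun t hat => by
      have hta : t ≠ a := fun h => hirr a (h ▸ hat)
      have htb : t ≠ b := fun h => hj (Or.inl (h ▸ hat))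
      have hts : t ≠ s := by
        rintro rfl
        exact lt_asymm (hO _ _ ha) (hO _ _ hat)
      simp [y, hta, htb, hts])
  have hza' := (hpos z).1 hz a
  have hzb' := (hpos z).1 hz b
  simp only [T, mem_filter, mem_univ, true_and, true_or, forall_const, hza,
    true_iff] at hza'
  simp [T, hzy b hlt, y, hza', (he b).symm] at hzb'

end Auxiliary

/-- for `G' = G*`, `P^{G'} ⊇ P^G` iff `pa_G(s)` and `ch_G(s)` are complete
for every node `s`. -/
theorem stmt15 {V : Type*} [Fintype V] [DecidableEq V] [Nonempty V]
    (X : V → Type*) [∀ v, Fintype (X v)] (h2 : ∀ v, 1 < Fintype.card (X v))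
    (E : V → V → Prop) (hE : IsDAG E) :
    (∀ p : (∀ v, X v) → ℝ, IsPMF X p → Factorizes X E p →
      Factorizes X (fun a b => E b a) p) ↔
    (∀ s, GComplete E (paG E s) ∧ GComplete E (chG E s)) := by
  exact ⟨fun h s => ⟨complete_paG_of_factorizes_reverse h2 hE h s,
      complete_chG_of_factorizes_reverse h2 hE h s⟩,
    fun h _ _ hp => hp.reverse hE (fun s => (h s).1) fun s => (h s).2⟩
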